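/- arXiv:2605.01592 — 2 statements merged into one kernel-verified Lean document; each statement's English description precedes it below -/
import Mathlib

section
/- Let P be a simple polygon, let W be a witness set of P, and let w ∈ W. Then there exists a point w′ ∈ Vis(w) such that (W \ {w}) ∪ {w′} is a witness set of P of cardinality |W| and Vis(w′) is regular. -/
open Set

noncomputable section

abbrev Plane := EuclideanSpace ℝ (Fin 2)

/-- A simple polygon, given by a cyclic sequence of at least three distinct vertices
whose closed polygonal boundary curve is a Jordan polygon: two edges intersect exactly
when they are consecutive, and then only in their one shared endpoint. -/
structure SimplePolygon where
  n : ℕ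
  three_le : 3 ≤ n
  vertex : ℕ → Plane
  periodic : ∀ i, vertex (i + n) = vertex i
  inj : ∀ i < n, ∀ j < n, vertex i = vertex j → i = j
  jordan : ∀ i < n, ∀ j < n, i ≠ j →
    segment ℝ (vertex i) (vertex (i + 1)) ∩ segment ℝ (vertex j) (vertex (j + 1)) =
      if j = (i + 1) % n then {vertex (i + 1)}
      else if i = (j + 1) % n then {vertex (j + 1)}
      else ∅

namespace SimplePolygon

/-- The boundary curve of the polygon: the union of its edges. -/
def boundary (P : SimplePolygon) : Set Plane :=
  ⋃ i ∈ Finset.range P.n, segment ℝ (P.vertex i) (P.vertex (i + 1))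

/-- The polygon as a region: the boundary together with all bounded connected
components of the complement of the boundary. -/
def region (P : SimplePolygon) : Set Plane :=
  P.boundary ∪ {x | x ∉ P.boundary ∧
    Bornology.IsBounded (connectedComponentIn P.boundaryᶜ x)}

/-- Visibility region of a point `p`: all points `q` of the polygon such that the
closed segment `[p,q]` is contained in the polygon. -/
def Vis (P : SimplePolygon) (p : Plane) : Set Plane :=
  {q | q ∈ P.region ∧ segment ℝ p q ⊆ P.region}

/-- Visibility region of a set. -/
def VisSet (P : SimplePolygon) (S : Set Plane) : Set Plane :=
  ⋃ p ∈ S, P.Vis p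

/-- Two points of the polygon are visible to each other if the segment joining them
lies in the polygon. -/
def Visible (P : SimplePolygon) (p q : Plane) : Prop :=
  p ∈ P.region ∧ q ∈ P.region ∧ segment ℝ p q ⊆ P.region

/-- A witness set: a finite set of points of the polygon with pairwise disjoint
visibility regions. -/
def IsWitnessSet (P : SimplePolygon) (W : Set Plane) : Prop :=
  W.Finite ∧ W ⊆ P.region ∧
    ∀ x ∈ W, ∀ y ∈ W, x ≠ y → P.Vis x ∩ P.Vis y = ∅

/-- The non-visible region of a witness set. -/
def NVis (P : SimplePolygon) (W : Set Plane) : Set Plane :=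
  P.region \ ⋃ w ∈ W, P.Vis w

/-- `Vis p` is regular (has no arms) if it equals the closure of its interior. -/
def VisRegular (P : SimplePolygon) (p : Plane) : Prop :=
  P.Vis p = closure (interior (P.Vis p))

/-- A window of `Vis p`: a non-degenerate closed segment contained in the frontier of
`Vis p` whose intersection with the frontier of the polygon is exactly its two
endpoints, maximal with these properties. -/
def IsWindow (P : SimplePolygon) (p : Plane) (e : Set Plane) : Prop :=
  ∃ a b : Plane, a ≠ b ∧ e = segment ℝ a b ∧
    e ⊆ frontier (P.Vis p) ∧
    e ∩ frontier P.region = {a, b} ∧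
    ∀ a' b' : Plane, a' ≠ b' →
      segment ℝ a' b' ⊆ frontier (P.Vis p) →
      segment ℝ a' b' ∩ frontier P.region = {a', b'} →
      e ⊆ segment ℝ a' b' → e = segment ℝ a' b'

/-- `γ` is (the image of) a neighbor witness path between `w` and `w'`. -/
def IsNWPath (P : SimplePolygon) (W : Set Plane) (w w' : Plane) (γ : Set Plane) : Prop :=
  ∃ f : Path w w', γ = Set.range f ∧ γ ⊆ P.Vis w ∪ P.NVis W ∪ P.Vis w'

/-- Adjacency in the neighbor witness graph `GCon(W)`. -/
def GConAdj (P : SimplePolygon) (W : Set Plane) (w w' : Plane) : Prop :=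
  w ∈ W ∧ w' ∈ W ∧ w ≠ w' ∧ ∃ γ : Set Plane, P.IsNWPath W w w' γ

/-- A connected component `NV` of `NVis W` is attached to `Vis w` if the closure of
`NV` intersects `Vis w`. -/
def Attached (P : SimplePolygon) (NV : Set Plane) (w : Plane) : Prop :=
  (closure NV ∩ P.Vis w).Nonempty

/-- `w` is a simplicial vertex of `GCon(W)`: its neighbors are pairwise adjacent. -/
def Simplicial (P : SimplePolygon) (W : Set Plane) (w : Plane) : Prop :=
  ∀ u v : Plane, P.GConAdj W w u → P.GConAdj W w v → u ≠ v → P.GConAdj W u v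

end SimplePolygon

/-- `NV` is a connected component of `S`. -/
def IsCompOf (NV S : Set Plane) : Prop :=
  ∃ x ∈ S, NV = connectedComponentIn S x

/-- The signed angle under which the segment from `a` to `b` is seen from `z`. -/
def viewAngle (a b z : ℂ) : ℝ := Complex.arg ((b - z) / (a - z))

/-- The total signed angle under which the polygonal path `c 0, …, c n` is seen from `z`. -/
def angleSum (c : ℕ → ℂ) (n : ℕ) (z : ℂ) : ℝ :=
  ∑ i ∈ Finset.range n, viewAngle (c i) (c (i + 1)) z

lemma div_mem_slitPlane_of_notMem_segment {a b z : ℂ} (h : z ∉ segment ℝ a b) :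
    (b - z) / (a - z) ∈ Complex.slitPlane := by
  rw [Complex.mem_slitPlane_iff_not_le_zero]
  intro hle
  apply h
  have haz : a - z ≠ 0 := by
    intro h0
    exact h (sub_eq_zero.mp h0 ▸ left_mem_segment ℝ a b)
  rw [Complex.nonpos_iff] at hle
  obtain ⟨s, hs⟩ : ∃ s : ℝ, s = -((b - z) / (a - z)).re := ⟨_, rfl⟩
  have hs0 : 0 ≤ s := by linarith [hle.1]
  have hr : (b - z) / (a - z) = -(s : ℂ) := by
    apply Complex.ext
    · simp [hs]
    · simp [hle.2]
  rw [div_eq_iff haz] at hr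
  have h1 : (1 + s : ℝ) ≠ 0 := by positivity
  have h1' : (1 + s : ℂ) ≠ 0 := by exact_mod_cast h1
  refine ⟨s / (1 + s), 1 / (1 + s), by positivity, by positivity, by field_simp; ring, ?_⟩
  simp only [Complex.real_smul]
  push_cast
  field_simp
  linear_combination hr

lemma continuousAt_viewAngle {a b z : ℂ} (h : z ∉ segment ℝ a b) :
    ContinuousAt (viewAngle a b) z := by
  have haz : a - z ≠ 0 := by
    intro h0
    exact h (sub_eq_zero.mp h0 ▸ left_mem_segment ℝ a b)
  unfold viewAngle
  refine ContinuousAt.comp (g := Complex.arg)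
    (Complex.continuousAt_arg (div_mem_slitPlane_of_notMem_segment h)) ?_
  exact ContinuousAt.div (by fun_prop) (by fun_prop) haz

lemma exists_angleSum_eq {c : ℕ → ℂ} {n : ℕ} (hc : c n = c 0) {z : ℂ} (hz : ∀ i, c i ≠ z) :
    ∃ k : ℤ, angleSum c n z = k * (2 * Real.pi) := by
  have key : Complex.exp (angleSum c n z * Complex.I) = 1 := by
    unfold angleSum viewAngle
    push_cast
    rw [Finset.sum_mul, Complex.exp_sum]
    have hterm : ∀ i, Complex.exp (((c (i + 1) - z) / (c i - z)).arg * Complex.I) =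
        ((c (i + 1) - z) / ‖c (i + 1) - z‖) / ((c i - z) / ‖c i - z‖) := by
      intro i
      have h0 : ∀ i, c i - z ≠ 0 := fun i => sub_ne_zero.mpr (hz i)
      have h0' : ∀ i, (‖c i - z‖ : ℂ) ≠ 0 := fun i => by
        exact_mod_cast norm_ne_zero_iff.mpr (h0 i)
      have h := Complex.norm_mul_exp_arg_mul_I ((c (i + 1) - z) / (c i - z))
      rw [norm_div] at h
      push_cast at h
      have h1 := h0 i
      have h2 := h0' i
      have h3 := h0' (i + 1)
      rw [← mul_right_inj' (div_ne_zero h3 h2), h]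
      field_simp
    rw [Finset.prod_congr rfl fun i _ => hterm i]
    have hne : ∀ i, (c i - z) / (‖c i - z‖ : ℂ) ≠ 0 := fun i => by
      have := sub_ne_zero.mpr (hz i)
      simpa [sub_eq_zero] using hz i
    have htel : ∀ m, ∏ i ∈ Finset.range m,
        ((c (i + 1) - z) / ‖c (i + 1) - z‖) / ((c i - z) / ‖c i - z‖) =
        ((c m - z) / ‖c m - z‖) / ((c 0 - z) / ‖c 0 - z‖) := by
      intro m
      induction m with
      | zero => simp [div_self (hne 0)]
      | succ m ih =>
        rw [Finset.prod_range_succ, ih, mul_comm, div_mul_div_cancel₀ (hne m)]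
    rw [htel, hc, div_self (hne 0)]
  rw [Complex.exp_eq_one_iff] at key
  obtain ⟨k, hk⟩ := key
  refine ⟨k, ?_⟩
  have hk' : ((angleSum c n z : ℝ) : ℂ) = ((k * (2 * Real.pi) : ℝ) : ℂ) := by
    apply mul_right_cancel₀ Complex.I_ne_zero
    rw [hk]
    push_cast
    ring
  exact_mod_cast hk'

lemma tendsto_viewAngle_cobounded (a b : ℂ) :
    Filter.Tendsto (viewAngle a b) (Bornology.cobounded ℂ) (nhds 0) := by
  have h1 : Filter.Tendsto (fun z : ℂ => (b - z) / (a - z)) (Bornology.cobounded ℂ) (nhds 1) := by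
    have hsub : Filter.Tendsto (fun z : ℂ => a - z) (Bornology.cobounded ℂ)
        (Bornology.cobounded ℂ) := by
      rw [← tendsto_norm_atTop_iff_cobounded]
      refine Filter.tendsto_atTop_mono (fun z => ?_)
        (Filter.tendsto_atTop_add_const_right _ (-‖a‖) tendsto_norm_cobounded_atTop)
      have := norm_sub_norm_le z a
      rw [norm_sub_rev a z]
      linarith
    have h2 : Filter.Tendsto (fun z : ℂ => 1 + (b - a) * (a - z)⁻¹) (Bornology.cobounded ℂ)
        (nhds (1 + (b - a) * 0)) :=
      ((Filter.tendsto_inv₀_cobounded.comp hsub).const_mul _).const_add _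
    rw [mul_zero, add_zero] at h2
    refine h2.congr' ?_
    have hne : ∀ᶠ z in Bornology.cobounded ℂ, z ≠ a := by
      have h : Bornology.IsBounded ({a} : Set ℂ) := Bornology.isBounded_singleton
      exact Bornology.isBounded_def.mp h
    filter_upwards [hne] with z hz
    have : a - z ≠ 0 := sub_ne_zero.mpr (Ne.symm hz)
    field_simp
    ring
  have h3 := (Complex.continuousAt_arg (x := 1) (by simp)).tendsto.comp h1
  rw [Complex.arg_one] at h3
  exact h3

lemma tendsto_angleSum_cobounded (c : ℕ → ℂ) (n : ℕ) :
    Filter.Tendsto (angleSum c n) (Bornology.cobounded ℂ) (nhds 0) := by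
  have := tendsto_finsetSum (Finset.range n)
    fun i _ => tendsto_viewAngle_cobounded (c i) (c (i + 1))
  rw [Finset.sum_const_zero] at this
  exact this

lemma viewAngle_normal_offset {a b : ℂ} (hab : a ≠ b) (s t : ℝ) :
    viewAngle a b (a + s * (b - a) + t * (Complex.I * (b - a))) =
      Complex.arg (-((1 - s) - t * Complex.I) / (s + t * Complex.I)) := by
  have h : b - a ≠ 0 := sub_ne_zero.mpr hab.symm
  unfold viewAngle
  congr 1
  have e1 : b - (a + s * (b - a) + t * (Complex.I * (b - a))) =
      (b - a) * ((1 - s) - t * Complex.I) := by ring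
  have e2 : a - (a + s * (b - a) + t * (Complex.I * (b - a))) =
      (b - a) * (-(s + t * Complex.I)) := by ring
  rw [e1, e2, mul_div_mul_left _ _ h, div_neg, neg_div]

lemma tendsto_normal_offset_ratio {s : ℝ} (hs : 0 < s) (l : Filter ℝ) (hl : l ≤ nhds 0) :
    Filter.Tendsto (fun t : ℝ => -((1 - s) - t * Complex.I) / (s + t * Complex.I)) l
      (nhds (-(((1 - s) / s : ℝ) : ℂ))) := by
  have hs' : (s : ℂ) ≠ 0 := by exact_mod_cast hs.ne'
  have : ContinuousAt (fun t : ℝ => -((1 - s : ℂ) - t * Complex.I) / (s + t * Complex.I)) 0 :=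
    ContinuousAt.div (by fun_prop) (by fun_prop) (by simpa using hs')
  have h := this.tendsto.mono_left hl
  convert h using 2
  push_cast
  simp
  ring

lemma normal_offset_ratio_im (s t : ℝ) :
    (-((1 - s) - t * Complex.I) / (s + t * Complex.I)).im = t / (s ^ 2 + t ^ 2) := by
  rw [Complex.div_im]
  simp [Complex.normSq_apply]
  ring

lemma tendsto_viewAngle_pos {a b : ℂ} (hab : a ≠ b) {s : ℝ} (h0 : 0 < s) (h1 : s < 1) :
    Filter.Tendsto (fun t : ℝ => viewAngle a b (a + s * (b - a) + t * (Complex.I * (b - a))))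
      (nhdsWithin 0 (Ioi 0)) (nhds Real.pi) := by
  simp_rw [viewAngle_normal_offset hab]
  have hneg : ((-(((1 - s) / s : ℝ) : ℂ)) : ℂ).re < 0 := by
    simp only [Complex.neg_re, Complex.ofReal_re, neg_lt_zero]
    exact div_pos (by linarith) h0
  have him : ((-(((1 - s) / s : ℝ) : ℂ)) : ℂ).im = 0 := by
    simp only [Complex.neg_im, Complex.ofReal_im, neg_zero]
  have hc := (Complex.continuousWithinAt_arg_of_re_neg_of_im_zero hneg him).tendsto
  rw [Complex.arg_eq_pi_iff.mpr ⟨hneg, him⟩] at hc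
  refine hc.comp (tendsto_nhdsWithin_iff.mpr
    ⟨tendsto_normal_offset_ratio h0 _ nhdsWithin_le_nhds, ?_⟩)
  filter_upwards [self_mem_nhdsWithin] with t ht
  rw [normal_offset_ratio_im]
  have : (0 : ℝ) < t := ht
  positivity

lemma tendsto_viewAngle_neg {a b : ℂ} (hab : a ≠ b) {s : ℝ} (h0 : 0 < s) (h1 : s < 1) :
    Filter.Tendsto (fun t : ℝ => viewAngle a b (a + s * (b - a) + t * (Complex.I * (b - a))))
      (nhdsWithin 0 (Iio 0)) (nhds (-Real.pi)) := by
  simp_rw [viewAngle_normal_offset hab]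
  have hneg : ((-(((1 - s) / s : ℝ) : ℂ)) : ℂ).re < 0 := by
    simp only [Complex.neg_re, Complex.ofReal_re, neg_lt_zero]
    exact div_pos (by linarith) h0
  have him : ((-(((1 - s) / s : ℝ) : ℂ)) : ℂ).im = 0 := by
    simp only [Complex.neg_im, Complex.ofReal_im, neg_zero]
  have hc := Complex.tendsto_arg_nhdsWithin_im_neg_of_re_neg_of_im_zero hneg him
  refine hc.comp (tendsto_nhdsWithin_iff.mpr
    ⟨tendsto_normal_offset_ratio h0 _ nhdsWithin_le_nhds, ?_⟩)
  filter_upwards [self_mem_nhdsWithin] with t ht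
  rw [normal_offset_ratio_im]
  have ht' : t < 0 := ht
  exact div_neg_of_neg_of_pos ht' (by positivity)

namespace SimplePolygon

variable (P : SimplePolygon)

lemma vertex_mod (i : ℕ) : P.vertex (i % P.n) = P.vertex i :=
  Function.Periodic.map_mod_nat P.periodic i

lemma n_pos : 0 < P.n := by
  have := P.three_le
  omega

lemma succ_mod_ne {k : ℕ} (hk : k < P.n) : (k + 1) % P.n ≠ k := by
  have := P.three_le
  rcases Nat.lt_or_ge (k + 1) P.n with h | h
  · rw [Nat.mod_eq_of_lt h]
    omega
  · have : k + 1 = P.n := by omega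
    rw [this, Nat.mod_self]
    omega

lemma vertex_ne_vertex_succ {k : ℕ} (hk : k < P.n) : P.vertex k ≠ P.vertex (k + 1) := by
  intro h
  rw [← P.vertex_mod (k + 1)] at h
  exact P.succ_mod_ne hk (P.inj _ hk _ (Nat.mod_lt _ P.n_pos) h).symm

lemma eq_vertex_of_mem_edges {i k : ℕ} (hi : i < P.n) (hk : k < P.n) (hik : i ≠ k) {m : Plane}
    (hmi : m ∈ segment ℝ (P.vertex i) (P.vertex (i + 1)))
    (hmk : m ∈ segment ℝ (P.vertex k) (P.vertex (k + 1))) :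
    (m = P.vertex k ∧ k = (i + 1) % P.n) ∨ (m = P.vertex (k + 1) ∧ i = (k + 1) % P.n) := by
  have h : m ∈ segment ℝ (P.vertex i) (P.vertex (i + 1)) ∩
    segment ℝ (P.vertex k) (P.vertex (k + 1)) := ⟨hmi, hmk⟩
  rw [P.jordan i hi k hk hik] at h
  split_ifs at h with h1 h2
  · left
    refine ⟨?_, h1⟩
    rw [h1, P.vertex_mod]
    exact h
  · exact Or.inr ⟨h, h2⟩
  · exact absurd h (notMem_empty m)

/-- The points lying in bounded components of the complement of the boundary. -/
def inside : Set Plane :=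
  {x | x ∉ P.boundary ∧ Bornology.IsBounded (connectedComponentIn P.boundaryᶜ x)}

lemma mem_boundary {x : Plane} :
    x ∈ P.boundary ↔ ∃ i < P.n, x ∈ segment ℝ (P.vertex i) (P.vertex (i + 1)) := by
  simp [boundary]

lemma inside_subset_region : P.inside ⊆ P.region := subset_union_right

lemma boundary_subset_region : P.boundary ⊆ P.region := subset_union_left

lemma isCompact_segment_plane (a b : Plane) : IsCompact (segment ℝ a b) := by
  rw [segment_eq_image_lineMap]
  exact isCompact_Icc.image (AffineMap.lineMap_continuous)

lemma isCompact_boundary : IsCompact P.boundary :=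
  (Finset.range P.n).isCompact_biUnion fun _ _ => isCompact_segment_plane _ _

lemma isOpen_compl_boundary : IsOpen P.boundaryᶜ := P.isCompact_boundary.isClosed.isOpen_compl

lemma mem_inside_of_joined {x y : Plane} {S : Set Plane} (hx : x ∈ P.inside)
    (hS : IsPreconnected S) (hSb : Disjoint S P.boundary) (hxS : x ∈ S) (hyS : y ∈ S) :
    y ∈ P.inside := by
  have hy := hS.subset_connectedComponentIn hxS hSb.subset_compl_right hyS
  refine ⟨connectedComponentIn_subset _ _ hy, ?_⟩
  rw [← connectedComponentIn_eq hy]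
  exact hx.2

lemma mem_inside_of_segment {x y : Plane} (hx : x ∈ P.inside)
    (h : Disjoint (segment ℝ x y) P.boundary) : y ∈ P.inside :=
  P.mem_inside_of_joined hx (convex_segment x y).isPreconnected h
    (left_mem_segment ℝ x y) (right_mem_segment ℝ x y)

lemma isOpen_inside : IsOpen P.inside := by
  rw [isOpen_iff_mem_nhds]
  intro x hx
  refine Filter.mem_of_superset
    ((P.isOpen_compl_boundary.connectedComponentIn (x := x)).mem_nhds
      (mem_connectedComponentIn hx.1)) ?_
  intro y hy
  refine ⟨connectedComponentIn_subset _ _ hy, ?_⟩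
  rw [← connectedComponentIn_eq hy]
  exact hx.2

lemma isClosed_region : IsClosed P.region := by
  rw [← isOpen_compl_iff, isOpen_iff_mem_nhds]
  intro x hx
  have hxb : x ∉ P.boundary := fun h => hx (P.boundary_subset_region h)
  refine Filter.mem_of_superset
    ((P.isOpen_compl_boundary.connectedComponentIn (x := x)).mem_nhds
      (mem_connectedComponentIn hxb)) ?_
  intro y hy hyr
  rcases hyr with h | h
  · exact connectedComponentIn_subset _ _ hy h
  · apply hx
    right
    refine ⟨hxb, ?_⟩
    rw [connectedComponentIn_eq hy]
    exact h.2

lemma isBounded_region : Bornology.IsBounded P.region := by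
  obtain ⟨R, hR⟩ := P.isCompact_boundary.isBounded.subset_closedBall 0
  refine (Metric.isBounded_closedBall (x := (0 : Plane)) (r := max R 1)).subset ?_
  intro z hz
  by_contra hzR
  rw [mem_closedBall_zero_iff, not_le, max_lt_iff] at hzR
  rcases hz with hz | hz
  · have := hR hz
    rw [mem_closedBall_zero_iff] at this
    linarith
  · have hconn : IsPreconnected ((fun t : ℝ => t • z) '' Ici 1) :=
      (convex_Ici 1).isPreconnected.image _ (by fun_prop)
    have hsub : (fun t : ℝ => t • z) '' Ici 1 ⊆ P.boundaryᶜ := by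
      rintro _ ⟨t, ht, rfl⟩ hb
      have h1 := hR hb
      have ht' : (1 : ℝ) ≤ t := ht
      rw [mem_closedBall_zero_iff, norm_smul, Real.norm_of_nonneg (by linarith)] at h1
      nlinarith
    have hcc := hconn.subset_connectedComponentIn (x := z) ⟨1, self_mem_Ici, one_smul ℝ z⟩ hsub
    obtain ⟨M, hM⟩ := (hz.2.subset hcc).exists_norm_le
    have h2 := hM ((|M| + 2) • z) ⟨|M| + 2, by
      have := abs_nonneg M
      change (1 : ℝ) ≤ _
      linarith, rfl⟩
    have h3 := abs_nonneg M
    have h4 := le_abs_self M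
    rw [norm_smul, Real.norm_of_nonneg (by linarith)] at h2
    nlinarith

lemma isCompact_region : IsCompact P.region :=
  Metric.isCompact_of_isClosed_isBounded P.isClosed_region P.isBounded_region

/-- The identification of the plane with `ℂ`. -/
def toC : Plane ≃ₗᵢ[ℝ] ℂ := Complex.orthonormalBasisOneI.repr.symm

lemma toC_mem_segment_iff {x a b : Plane} :
    toC x ∈ segment ℝ (toC a) (toC b) ↔ x ∈ segment ℝ a b := by
  have h := image_segment ℝ (toC.toLinearEquiv.toLinearMap.toAffineMap) a b
  have h' : toC '' segment ℝ a b = segment ℝ (toC a) (toC b) := h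
  rw [← h', toC.injective.mem_set_image]

/-- `2π` times the winding number of the boundary curve around `z`. -/
def winding (z : Plane) : ℝ := angleSum (fun i => toC (P.vertex i)) P.n (toC z)

lemma vertex_mem_boundary (i : ℕ) : P.vertex i ∈ P.boundary := by
  rw [← P.vertex_mod, P.mem_boundary]
  exact ⟨_, Nat.mod_lt _ P.n_pos, left_mem_segment _ _ _⟩

lemma continuousAt_winding {z : Plane} (hz : z ∉ P.boundary) : ContinuousAt P.winding z := by
  unfold winding angleSum
  refine tendsto_finsetSum _ fun i hi => ?_
  refine ContinuousAt.comp (g := viewAngle _ _) (f := toC) (x := z)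
    (continuousAt_viewAngle ?_) toC.continuous.continuousAt
  rw [toC_mem_segment_iff]
  intro h
  exact hz (P.mem_boundary.mpr ⟨i, Finset.mem_range.mp hi, h⟩)

lemma exists_winding_eq {z : Plane} (hz : z ∉ P.boundary) :
    ∃ k : ℤ, P.winding z = k * (2 * Real.pi) := by
  apply exists_angleSum_eq
  · have := P.periodic 0
    rw [zero_add] at this
    simp only [this]
  · intro i h
    exact hz (toC.injective h ▸ P.vertex_mem_boundary i)

lemma winding_eq_zero {z : Plane} (hz : z ∉ P.region) : P.winding z = 0 := by
  have hzb : z ∉ P.boundary := fun h => hz (P.boundary_subset_region h)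
  have hunb : ¬ Bornology.IsBounded (connectedComponentIn P.boundaryᶜ z) :=
    fun h => hz (Or.inr ⟨hzb, h⟩)
  have hfar : ∀ᶠ y : Plane in Bornology.cobounded Plane, |P.winding y| < 2 * Real.pi := by
    have htoC : Filter.Tendsto toC (Bornology.cobounded Plane) (Bornology.cobounded ℂ) := by
      rw [← tendsto_norm_atTop_iff_cobounded]
      simp only [LinearIsometryEquiv.norm_map]
      exact tendsto_norm_cobounded_atTop
    have h := (tendsto_angleSum_cobounded (fun i => toC (P.vertex i)) P.n).comp htoC
    have h2 := h.abs
    rw [abs_zero] at h2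
    exact h2.eventually_lt_const (by positivity)
  obtain ⟨y, hyc, hy⟩ :
      ∃ y ∈ connectedComponentIn P.boundaryᶜ z, |P.winding y| < 2 * Real.pi := by
    by_contra! hcon
    apply hunb
    rw [Bornology.isBounded_def]
    filter_upwards [hfar] with y hy hyc
    exact absurd hy (not_lt.mpr (hcon y hyc))
  have hyb : y ∉ P.boundary := connectedComponentIn_subset _ _ hyc
  have hpi := Real.pi_pos
  have hy0 : P.winding y = 0 := by
    obtain ⟨k, hk⟩ := P.exists_winding_eq hyb
    rw [hk, abs_mul, abs_of_pos (by positivity : 0 < 2 * Real.pi)] at hy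
    have h1 : |(k : ℝ)| < 1 := by
      by_contra! hge
      nlinarith
    have hk0 : k = 0 := by
      rw [← Int.abs_lt_one_iff]
      exact_mod_cast h1
    rw [hk, hk0]
    simp
  obtain ⟨k, hk⟩ := P.exists_winding_eq hzb
  have hcont : ContinuousOn P.winding (connectedComponentIn P.boundaryᶜ z) := fun x hx =>
    (P.continuousAt_winding (connectedComponentIn_subset _ _ hx)).continuousWithinAt
  have hnopi : ∀ x ∈ connectedComponentIn P.boundaryᶜ z, ∀ j : ℤ,
      P.winding x ≠ (2 * j + 1) * Real.pi := by
    intro x hx j hj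
    obtain ⟨l, hl⟩ := P.exists_winding_eq (connectedComponentIn_subset _ _ hx)
    rw [hl, ← mul_assoc] at hj
    have h1 := mul_right_cancel₀ hpi.ne' hj
    have h2 : l * 2 = 2 * j + 1 := by exact_mod_cast h1
    omega
  have hzc : z ∈ connectedComponentIn P.boundaryᶜ z := mem_connectedComponentIn hzb
  rcases lt_trichotomy k 0 with hk0 | hk0 | hk0
  · have hk1 : (k : ℝ) ≤ -1 := by exact_mod_cast Int.le_sub_one_of_lt hk0
    obtain ⟨x, hx, hxw⟩ := isPreconnected_connectedComponentIn.intermediate_value hzc hyc hcont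
      (show -Real.pi ∈ Icc (P.winding z) (P.winding y) from by
        rw [hk, hy0]
        constructor <;> nlinarith)
    exact absurd (hxw.trans (by push_cast; ring)) (hnopi x hx (-1))
  · rw [hk, hk0]
    simp
  · have hk1 : (1 : ℝ) ≤ k := by exact_mod_cast hk0
    obtain ⟨x, hx, hxw⟩ := isPreconnected_connectedComponentIn.intermediate_value hyc hzc hcont
      (show Real.pi ∈ Icc (P.winding y) (P.winding z) from by
        rw [hk, hy0]
        constructor <;> nlinarith)
    exact absurd (hxw.trans (by push_cast; ring)) (hnopi x hx 0)

lemma mem_closure_inside_of_mem_openSegment {k : ℕ} (hk : k < P.n) {m : Plane}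
    (hm : m ∈ openSegment ℝ (P.vertex k) (P.vertex (k + 1))) : m ∈ closure P.inside := by
  by_contra hcl
  set a := toC (P.vertex k) with ha
  set b := toC (P.vertex (k + 1)) with hb
  have hab : a ≠ b := fun h => P.vertex_ne_vertex_succ hk (toC.injective h)
  have hba : b - a ≠ 0 := sub_ne_zero.mpr hab.symm
  have hmseg := openSegment_subset_segment ℝ _ _ hm
  rw [openSegment_eq_image_lineMap] at hm
  obtain ⟨s, ⟨h0, h1⟩, hms⟩ := hm
  have hms' : toC m = a + s * (b - a) := by
    rw [← hms, AffineMap.lineMap_apply_module', map_add, map_smul, map_sub, Complex.real_smul,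
      add_comm]
  have hother : ∀ i < P.n, i ≠ k → m ∉ segment ℝ (P.vertex i) (P.vertex (i + 1)) := by
    intro i hi hik hmi
    rcases P.eq_vertex_of_mem_edges hi hk hik hmi hmseg with ⟨h, -⟩ | ⟨h, -⟩
    · rw [h] at hms'
      have h2 : (s : ℂ) * (b - a) = 0 := by linear_combination -hms'
      rcases mul_eq_zero.mp h2 with h3 | h3
      · exact h0.ne' (by exact_mod_cast h3)
      · exact hba h3
    · rw [h, ← hb] at hms'
      have h2 : (1 - s : ℂ) * (b - a) = 0 := by linear_combination hms'
      rcases mul_eq_zero.mp h2 with h3 | h3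
      · have : (1 - s : ℝ) = 0 := by exact_mod_cast h3
        linarith
      · exact hba h3
  let ν : ℝ → ℂ := fun t => a + s * (b - a) + t * (Complex.I * (b - a))
  have hν : Continuous ν := by fun_prop
  have hν0 : ν 0 = toC m := by simp [ν, hms']
  let f : ℝ → Plane := fun t => toC.symm (ν t)
  have hf : Continuous f := toC.symm.continuous.comp hν
  have hf0 : f 0 = m := by simp [f, hν0]
  -- near `m`, off the edge, the points are outside the region
  have hne : ∀ᶠ t in nhds (0 : ℝ), t ≠ 0 → f t ∉ P.region := by
    have e1 : ∀ᶠ t in nhds (0 : ℝ), f t ∉ P.inside := by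
      have : ∀ᶠ x in nhds m, x ∉ closure P.inside := isClosed_closure.isOpen_compl.mem_nhds hcl
      have := (hf.tendsto' 0 m hf0).eventually this
      filter_upwards [this] with t ht h
      exact ht (subset_closure h)
    have e2 : ∀ᶠ t in nhds (0 : ℝ), ∀ i ∈ Finset.range P.n, i ≠ k →
        f t ∉ segment ℝ (P.vertex i) (P.vertex (i + 1)) := by
      rw [Finset.eventually_all]
      intro i hi
      by_cases hik : i = k
      · simp [hik]
      · have : ∀ᶠ x in nhds m, x ∉ segment ℝ (P.vertex i) (P.vertex (i + 1)) :=
          (isCompact_segment_plane _ _).isClosed.isOpen_compl.mem_nhds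
            (hother i (Finset.mem_range.mp hi) hik)
        have := (hf.tendsto' 0 m hf0).eventually this
        filter_upwards [this] with t ht _
        exact ht
    filter_upwards [e1, e2] with t ht1 ht2 ht0 htr
    rcases htr with htr | htr
    · obtain ⟨i, hi, hti⟩ := P.mem_boundary.mp htr
      by_cases hik : i = k
      · subst hik
        rw [← toC_mem_segment_iff, ← ha, ← hb, segment_eq_image_lineMap] at hti
        obtain ⟨r, -, hr⟩ := hti
        rw [AffineMap.lineMap_apply_module', Complex.real_smul] at hr
        simp only [f, LinearIsometryEquiv.apply_symm_apply, ν] at hr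
        have h2 : ((r - s : ℂ) - t * Complex.I) * (b - a) = 0 := by linear_combination hr
        have h3 := (mul_eq_zero.mp h2).resolve_right hba
        have h4 := congrArg Complex.im h3
        simp at h4
        exact ht0 h4
      · exact ht2 i (Finset.mem_range.mpr hi) hik hti
    · exact ht1 htr
  let rest : ℂ → ℝ := fun z => ∑ i ∈ (Finset.range P.n).erase k,
    viewAngle (toC (P.vertex i)) (toC (P.vertex (i + 1))) z
  have hsum : ∀ t, P.winding (f t) = viewAngle a b (ν t) + rest (ν t) := by
    intro t
    simp only [winding, angleSum, f, LinearIsometryEquiv.apply_symm_apply, rest]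
    exact (Finset.add_sum_erase _ _ (Finset.mem_range.mpr hk)).symm
  have hrest : Filter.Tendsto (fun t => rest (ν t)) (nhds 0) (nhds (rest (toC m))) := by
    have h1 : ContinuousAt rest (ν 0) := by
      refine tendsto_finsetSum _ fun i hi => ?_
      rw [hν0]
      refine continuousAt_viewAngle ?_
      rw [toC_mem_segment_iff]
      rw [Finset.mem_erase, Finset.mem_range] at hi
      exact hother i hi.2 hi.1
    have h2 := h1.comp hν.continuousAt
    rw [← hν0]
    exact h2
  have hpos : Real.pi + rest (toC m) = 0 := by
    have h2 := (tendsto_viewAngle_pos hab h0 h1).add (hrest.mono_left nhdsWithin_le_nhds)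
    refine tendsto_nhds_unique h2 (tendsto_const_nhds.congr' ?_)
    filter_upwards [self_mem_nhdsWithin, nhdsWithin_le_nhds hne] with t ht htr
    rw [← hsum, P.winding_eq_zero (htr (ne_of_gt ht))]
  have hneg : -Real.pi + rest (toC m) = 0 := by
    have h2 := (tendsto_viewAngle_neg hab h0 h1).add (hrest.mono_left nhdsWithin_le_nhds)
    refine tendsto_nhds_unique h2 (tendsto_const_nhds.congr' ?_)
    filter_upwards [self_mem_nhdsWithin, nhdsWithin_le_nhds hne] with t ht htr
    rw [← hsum, P.winding_eq_zero (htr (ne_of_lt ht))]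
  linarith [Real.pi_pos]

lemma region_subset_closure_inside : P.region ⊆ closure P.inside := by
  rintro x (hx | hx)
  · obtain ⟨k, hk, hxk⟩ := P.mem_boundary.mp hx
    have h := segment_subset_closure_openSegment hxk
    exact closure_minimal (fun m hm => P.mem_closure_inside_of_mem_openSegment hk hm)
      isClosed_closure h
  · exact subset_closure hx

/-- The two-dimensional cross product. -/
def cross (a b : Plane) : ℝ := a 0 * b 1 - a 1 * b 0

lemma continuous_cross_sub (d p : Plane) : Continuous fun y => cross d (y - p) := by
  unfold cross
  fun_prop

lemma cross_eq_zero_of_cross_eq_zero {d x y : Plane} (hd : d ≠ 0) (hx : cross d x = 0)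
    (hy : cross d y = 0) : cross x y = 0 := by
  unfold cross at *
  by_cases h0 : d 0 = 0
  · have h1 : d 1 ≠ 0 := by
      intro h1
      apply hd
      ext i
      fin_cases i
      · exact h0
      · exact h1
    apply mul_left_cancel₀ h1
    linear_combination x 1 * hy - y 1 * hx
  · apply mul_left_cancel₀ h0
    linear_combination x 0 * hy - y 0 * hx

lemma cross_lineMap_sub (d p x y : Plane) (t : ℝ) :
    cross d (AffineMap.lineMap x y t - p) =
      (1 - t) * cross d (x - p) + t * cross d (y - p) := by
  simp only [cross, AffineMap.lineMap_apply_module', PiLp.sub_apply, PiLp.add_apply,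
    PiLp.smul_apply, smul_eq_mul]
  ring

/-- The direction obtained from `d` by a quarter turn. -/
def quarterTurn (d : Plane) : Plane := !₂[-d 1, d 0]

lemma cross_quarterTurn_pos {d : Plane} (hd : d ≠ 0) : 0 < cross d (quarterTurn d) := by
  have h : cross d (quarterTurn d) = d 0 ^ 2 + d 1 ^ 2 := by
    simp [cross, quarterTurn]
    ring
  rw [h]
  by_contra! hle
  have h0 : d 0 = 0 := by nlinarith [sq_nonneg (d 0), sq_nonneg (d 1)]
  have h1 : d 1 = 0 := by nlinarith [sq_nonneg (d 0), sq_nonneg (d 1)]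
  apply hd
  ext i
  fin_cases i
  · exact h0
  · exact h1

lemma dense_setOf_cross_ne_zero {a b : Plane} (hab : a ≠ b) :
    Dense {p : Plane | cross (a - p) (b - p) ≠ 0} := by
  intro z
  by_cases hz : cross (a - z) (b - z) = 0
  · have hd : b - a ≠ 0 := sub_ne_zero.mpr hab.symm
    have hf : Continuous fun t : ℝ => z + t • quarterTurn (b - a) := by fun_prop
    have ht : Filter.Tendsto (fun t : ℝ => z + t • quarterTurn (b - a)) (nhdsWithin 0 (Ioi 0))
        (nhds z) := (hf.tendsto' 0 z (by simp)).mono_left nhdsWithin_le_nhds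
    refine mem_closure_of_tendsto ht ?_
    filter_upwards [self_mem_nhdsWithin] with t htpos
    have htpos' : 0 < t := htpos
    have key : cross (a - (z + t • quarterTurn (b - a))) (b - (z + t • quarterTurn (b - a))) =
        cross (a - z) (b - z) + t * cross (b - a) (quarterTurn (b - a)) := by
      simp only [cross, PiLp.sub_apply, PiLp.add_apply, PiLp.smul_apply, smul_eq_mul]
      ring
    change _ ≠ _
    rw [key, hz, zero_add]
    exact (mul_pos htpos' (cross_quarterTurn_pos hd)).ne'
  · exact subset_closure hz

/-- A point is generic if it lies on no line through two distinct vertices. -/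
def Generic (p : Plane) : Prop :=
  ∀ i j, P.vertex i ≠ P.vertex j → cross (P.vertex i - p) (P.vertex j - p) ≠ 0

lemma dense_generic : Dense {p | P.Generic p} := by
  have h : {p | P.Generic p} = ⋂ ij : {ij : ℕ × ℕ // P.vertex ij.1 ≠ P.vertex ij.2},
      {p | cross (P.vertex ij.1.1 - p) (P.vertex ij.1.2 - p) ≠ 0} := by
    ext p
    simp [Generic]
  rw [h]
  refine dense_iInter_of_isOpen (fun ij => ?_) fun ij => dense_setOf_cross_ne_zero ij.2
  refine isOpen_ne_fun ?_ continuous_const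
  unfold cross
  fun_prop

variable {P}

lemma Generic.vertex_eq {p d : Plane} (hp : P.Generic p) (hd : d ≠ 0) {i j : ℕ}
    (hi : cross d (P.vertex i - p) = 0) (hj : cross d (P.vertex j - p) = 0) :
    P.vertex i = P.vertex j := by
  by_contra h
  exact hp i j h (cross_eq_zero_of_cross_eq_zero hd hi hj)

lemma Generic.eq_of_mem_edge {p d : Plane} (hp : P.Generic p) (hd : d ≠ 0) {i : ℕ} (hi : i < P.n)
    {x y : Plane} (hx : x ∈ segment ℝ (P.vertex i) (P.vertex (i + 1)))
    (hy : y ∈ segment ℝ (P.vertex i) (P.vertex (i + 1)))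
    (hx0 : cross d (x - p) = 0) (hy0 : cross d (y - p) = 0) : x = y := by
  rw [segment_eq_image_lineMap] at hx hy
  obtain ⟨α, -, rfl⟩ := hx
  obtain ⟨β, -, rfl⟩ := hy
  rw [cross_lineMap_sub] at hx0 hy0
  by_cases hαβ : α = β
  · rw [hαβ]
  · exfalso
    have h1 : cross d (P.vertex i - p) = 0 := by
      apply mul_left_cancel₀ (sub_ne_zero.mpr hαβ)
      linear_combination α * hy0 - β * hx0
    have h2 : cross d (P.vertex (i + 1) - p) = 0 := by
      apply mul_left_cancel₀ (sub_ne_zero.mpr hαβ)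
      linear_combination (1 - β) * hx0 - (1 - α) * hy0
    exact P.vertex_ne_vertex_succ hi (hp.vertex_eq hd h1 h2)

/-- Along a line through a generic point, one side of the line is such that each point of the line
has at most one edge running into that side. -/
lemma Generic.exists_side {p d : Plane} (hp : P.Generic p) (hd : d ≠ 0) :
    ∃ σ : ℝ, σ ≠ 0 ∧ ∀ x, cross d (x - p) = 0 → ∀ i < P.n, ∀ j < P.n,
      x ∈ segment ℝ (P.vertex i) (P.vertex (i + 1)) →
      x ∈ segment ℝ (P.vertex j) (P.vertex (j + 1)) →
      (∃ y ∈ segment ℝ (P.vertex i) (P.vertex (i + 1)), 0 < σ * cross d (y - p)) →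
      (∃ y ∈ segment ℝ (P.vertex j) (P.vertex (j + 1)), 0 < σ * cross d (y - p)) → i = j := by
  have hvert : ∀ x, cross d (x - p) = 0 → ∀ i < P.n, ∀ j < P.n, i ≠ j →
      x ∈ segment ℝ (P.vertex i) (P.vertex (i + 1)) →
      x ∈ segment ℝ (P.vertex j) (P.vertex (j + 1)) → ∃ k < P.n, x = P.vertex k := by
    intro x _ i hi j hj hij hxi hxj
    rcases P.eq_vertex_of_mem_edges hi hj hij hxi hxj with ⟨h, -⟩ | ⟨h, -⟩
    · exact ⟨j, hj, h⟩
    · exact ⟨(j + 1) % P.n, Nat.mod_lt _ P.n_pos, by rw [P.vertex_mod, h]⟩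
  by_cases hv : ∃ k < P.n, cross d (P.vertex k - p) = 0
  · obtain ⟨k, hk, hk0⟩ := hv
    have hsucc : cross d (P.vertex (k + 1) - p) ≠ 0 := fun h =>
      P.vertex_ne_vertex_succ hk (hp.vertex_eq hd hk0 h)
    refine ⟨-cross d (P.vertex (k + 1) - p), neg_ne_zero.mpr hsucc, ?_⟩
    intro x hx i hi j hj hxi hxj hyi hyj
    by_contra hij
    obtain ⟨l, hl, hxl⟩ := hvert x hx i hi j hj hij hxi hxj
    have hxk : x = P.vertex k := by
      rw [hxl] at hx ⊢
      exact hp.vertex_eq hd hx hk0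
    have hpred : ∀ m < P.n, x ∈ segment ℝ (P.vertex m) (P.vertex (m + 1)) →
        (∃ y ∈ segment ℝ (P.vertex m) (P.vertex (m + 1)),
          0 < -cross d (P.vertex (k + 1) - p) * cross d (y - p)) → k = (m + 1) % P.n := by
      intro m hm hxm hym
      have hmk : m ≠ k := by
        rintro rfl
        obtain ⟨y, hy, hpos⟩ := hym
        rw [segment_eq_image_lineMap] at hy
        obtain ⟨t, ht, rfl⟩ := hy
        rw [cross_lineMap_sub, hk0] at hpos
        nlinarith [ht.1, mul_nonneg ht.1 (sq_nonneg (cross d (P.vertex (m + 1) - p)))]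
      rcases P.eq_vertex_of_mem_edges hm hk hmk hxm (hxk ▸ left_mem_segment _ _ _)
        with ⟨-, h⟩ | ⟨h, -⟩
      · exact h
      · exact absurd (hxk.symm.trans h) (P.vertex_ne_vertex_succ hk)
    have h1 := hpred i hi hxi hyi
    have h2 := hpred j hj hxj hyj
    have h3 : i ≡ j [MOD P.n] := Nat.ModEq.add_right_cancel' 1 (h1.symm.trans h2)
    exact hij (h3.eq_of_lt_of_lt hi hj)
  · refine ⟨1, one_ne_zero, ?_⟩
    intro x hx i hi j hj hxi hxj _ _
    by_contra hij
    obtain ⟨l, hl, hxl⟩ := hvert x hx i hi j hj hij hxi hxj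
    exact hv ⟨l, hl, hxl ▸ hx⟩

variable (P)

/-- Points close to `x` can only lie on edges through `x`. -/
lemma exists_ball_mem_edge (x : Plane) : ∃ ε > 0, ∀ y ∈ Metric.ball x ε, ∀ i < P.n,
    y ∈ segment ℝ (P.vertex i) (P.vertex (i + 1)) →
    x ∈ segment ℝ (P.vertex i) (P.vertex (i + 1)) := by
  have h : ∀ᶠ y in nhds x, ∀ i ∈ Finset.range P.n,
      y ∈ segment ℝ (P.vertex i) (P.vertex (i + 1)) →
      x ∈ segment ℝ (P.vertex i) (P.vertex (i + 1)) := by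
    rw [Finset.eventually_all]
    intro i _
    by_cases hx : x ∈ segment ℝ (P.vertex i) (P.vertex (i + 1))
    · simp [hx]
    · filter_upwards [(isCompact_segment_plane _ _).isClosed.isOpen_compl.mem_nhds hx] with y hy h
      exact absurd h hy
  obtain ⟨ε, hε, hb⟩ := Metric.eventually_nhds_iff_ball.mp h
  exact ⟨ε, hε, fun y hy i hi => hb y hy i (Finset.mem_range.mpr hi)⟩

lemma cross_eq_zero_of_mem_segment {a b x y z : Plane} (hx : x ∈ segment ℝ a b)
    (hy : y ∈ segment ℝ a b) (hz : z ∈ segment ℝ a b) : cross (y - x) (z - x) = 0 := by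
  rw [segment_eq_image_lineMap] at hx hy hz
  obtain ⟨α, -, rfl⟩ := hx
  obtain ⟨β, -, rfl⟩ := hy
  obtain ⟨γ, -, rfl⟩ := hz
  simp only [cross, AffineMap.lineMap_apply_module', PiLp.sub_apply, PiLp.add_apply,
    PiLp.smul_apply, smul_eq_mul]
  ring

variable {P}

lemma Generic.eventually_mem_region {p d : Plane} (hp : P.Generic p) (hd : d ≠ 0) {σ : ℝ}
    (hσ : ∀ x, cross d (x - p) = 0 → ∀ i < P.n, ∀ j < P.n,
      x ∈ segment ℝ (P.vertex i) (P.vertex (i + 1)) →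
      x ∈ segment ℝ (P.vertex j) (P.vertex (j + 1)) →
      (∃ y ∈ segment ℝ (P.vertex i) (P.vertex (i + 1)), 0 < σ * cross d (y - p)) →
      (∃ y ∈ segment ℝ (P.vertex j) (P.vertex (j + 1)), 0 < σ * cross d (y - p)) → i = j)
    {x : Plane} (hx : cross d (x - p) = 0)
    (hxr : ∀ᶠ s in nhds (0 : ℝ), x + s • d ∈ P.region) :
    ∀ᶠ y in nhds x, 0 < σ * cross d (y - p) → y ∈ P.region := by
  obtain ⟨ε, hε, hball⟩ := P.exists_ball_mem_edge x
  have hcont : Continuous fun s : ℝ => x + s • d := by fun_prop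
  have hb : ∀ᶠ s in nhds (0 : ℝ), x + s • d ∈ Metric.ball x ε :=
    (hcont.tendsto' 0 x (by simp)).eventually (Metric.ball_mem_nhds x hε)
  have hline : ∀ s : ℝ, cross d (x + s • d - p) = 0 := by
    intro s
    rw [← hx]
    simp only [cross, PiLp.sub_apply, PiLp.add_apply, PiLp.smul_apply, smul_eq_mul]
    ring
  have hin : ∀ s : ℝ, s ≠ 0 → x + s • d ∈ Metric.ball x ε → x + s • d ∈ P.region →
      x + s • d ∈ P.inside := by
    intro s hs hsb hsr
    refine hsr.resolve_left fun hbd => ?_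
    obtain ⟨i, hi, hsi⟩ := P.mem_boundary.mp hbd
    have := hp.eq_of_mem_edge hd hi (hball _ hsb i hi hsi) hsi hx (hline s)
    rw [left_eq_add, smul_eq_zero] at this
    exact this.elim hs hd
  obtain ⟨δ, hδ, hδb⟩ := Metric.eventually_nhds_iff_ball.mp (hxr.and hb)
  have hmem : ∀ s : ℝ, |s| = δ / 2 → x + s • d ∈ Metric.ball x ε ∧ x + s • d ∈ P.inside := by
    intro s hs
    have h1 := hδb s (by rw [mem_ball_zero_iff, Real.norm_eq_abs]; linarith)
    refine ⟨h1.2, hin s ?_ h1.2 h1.1⟩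
    rintro rfl
    rw [abs_zero] at hs
    linarith
  filter_upwards [Metric.ball_mem_nhds x hε] with y hy hpos
  by_contra hyr
  have hyb : y ∉ P.boundary := fun h => hyr (P.boundary_subset_region h)
  have hmeet : ∀ s : ℝ, |s| = δ / 2 → ∃ a : ℝ, 0 < a ∧ a < 1 ∧ ∃ i < P.n,
      AffineMap.lineMap (x + s • d) y a ∈ segment ℝ (P.vertex i) (P.vertex (i + 1)) ∧
      x ∈ segment ℝ (P.vertex i) (P.vertex (i + 1)) ∧
      0 < σ * cross d (AffineMap.lineMap (x + s • d) y a - p) := by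
    intro s hs
    obtain ⟨hsb, hsi⟩ := hmem s hs
    have hnd : ¬ Disjoint (segment ℝ (x + s • d) y) P.boundary := fun h =>
      hyr (P.inside_subset_region (P.mem_inside_of_segment hsi h))
    obtain ⟨u, hu, hub⟩ := not_disjoint_iff.mp hnd
    have hubal := (convex_ball x ε).segment_subset hsb hy hu
    rw [segment_eq_image_lineMap] at hu
    obtain ⟨a, ha, rfl⟩ := hu
    have ha0 : a ≠ 0 := by
      rintro rfl
      rw [AffineMap.lineMap_apply_zero] at hub
      exact hsi.1 hub
    have ha1 : a ≠ 1 := by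
      rintro rfl
      rw [AffineMap.lineMap_apply_one] at hub
      exact hyb hub
    have hapos : 0 < a := lt_of_le_of_ne ha.1 ha0.symm
    obtain ⟨i, hi, hui⟩ := P.mem_boundary.mp hub
    refine ⟨a, hapos, lt_of_le_of_ne ha.2 ha1, i, hi, hui, hball _ hubal i hi hui, ?_⟩
    rw [cross_lineMap_sub, hline]
    nlinarith [mul_pos hapos hpos]
  obtain ⟨a, ha0, ha1, i, hi, hui, hxi, hposi⟩ := hmeet (δ / 2) (abs_of_pos (by positivity))
  obtain ⟨b, hb0, hb1, j, hj, huj, hxj, hposj⟩ := hmeet (-(δ / 2)) (by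
    rw [abs_neg]
    exact abs_of_pos (by positivity))
  obtain rfl := hσ x hx i hi j hj hxi hxj ⟨_, hui, hposi⟩ ⟨_, huj, hposj⟩
  have hcr := cross_eq_zero_of_mem_segment hxi hui huj
  have key : cross (AffineMap.lineMap (x + (δ / 2) • d) y a - x)
      (AffineMap.lineMap (x + (-(δ / 2)) • d) y b - x) =
      δ / 2 * ((1 - a) * b + a * (1 - b)) * (cross d (y - p) - cross d (x - p)) := by
    simp only [cross, AffineMap.lineMap_apply_module', PiLp.sub_apply, PiLp.add_apply,
      PiLp.smul_apply, smul_eq_mul]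
    ring
  rw [key, hx, sub_zero] at hcr
  have h1 : 0 < (1 - a) * b := mul_pos (by linarith) hb0
  have h2 : 0 < a * (1 - b) := mul_pos ha0 (by linarith)
  have h3 : cross d (y - p) ≠ 0 := by
    intro h
    rw [h, mul_zero] at hpos
    exact lt_irrefl _ hpos
  exact mul_ne_zero (by positivity) h3 hcr

variable (P)

lemma mem_Vis {p q : Plane} : q ∈ P.Vis p ↔ segment ℝ p q ⊆ P.region :=
  ⟨fun h => h.2, fun h => ⟨h (right_mem_segment ℝ p q), h⟩⟩

lemma isClosed_setOf_visible : IsClosed {pq : Plane × Plane | segment ℝ pq.1 pq.2 ⊆ P.region} := by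
  have h : {pq : Plane × Plane | segment ℝ pq.1 pq.2 ⊆ P.region} =
      ⋂ t ∈ Icc (0 : ℝ) 1,
        (fun pq : Plane × Plane => AffineMap.lineMap pq.1 pq.2 t) ⁻¹' P.region := by
    ext pq
    simp only [segment_eq_image_lineMap, image_subset_iff, mem_iInter, mem_ofPred_eq]
    rfl
  rw [h]
  refine isClosed_biInter fun t _ => P.isClosed_region.preimage ?_
  simp only [AffineMap.lineMap_apply_module']
  fun_prop

lemma isClosed_Vis (p : Plane) : IsClosed (P.Vis p) := by
  have h : P.Vis p =
      (fun q => (p, q)) ⁻¹' {pq : Plane × Plane | segment ℝ pq.1 pq.2 ⊆ P.region} := by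
    ext q
    exact P.mem_Vis
  rw [h]
  exact P.isClosed_setOf_visible.preimage (by fun_prop)

lemma isCompact_Vis (p : Plane) : IsCompact (P.Vis p) :=
  P.isCompact_region.of_isClosed_subset (P.isClosed_Vis p) fun _ h => h.1

lemma self_mem_Vis {p : Plane} (hp : p ∈ P.region) : p ∈ P.Vis p := by
  rw [P.mem_Vis, segment_same, singleton_subset_iff]
  exact hp

lemma mem_interior_Vis_self {p : Plane} (hp : p ∈ P.inside) : p ∈ interior (P.Vis p) := by
  obtain ⟨ε, hε, hb⟩ := Metric.isOpen_iff.mp P.isOpen_inside p hp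
  refine mem_interior.mpr ⟨Metric.ball p ε, fun q hq => ?_, Metric.isOpen_ball,
    Metric.mem_ball_self hε⟩
  rw [P.mem_Vis]
  exact ((convex_ball p ε).segment_subset (Metric.mem_ball_self hε) hq).trans
    (hb.trans P.inside_subset_region)

variable {P}

lemma Generic.openSegment_subset {p q : Plane} (hp : P.Generic p) (hpi : p ∈ P.inside)
    (hq : q ∈ P.Vis p) (hpq : p ≠ q) :
    openSegment ℝ p q ⊆ closure (interior (P.Vis p)) := by
  rw [P.mem_Vis] at hq
  obtain ⟨d, hdef⟩ : ∃ d, d = q - p := ⟨_, rfl⟩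
  have hd : d ≠ 0 := by
    rw [hdef]
    exact sub_ne_zero.mpr hpq.symm
  obtain ⟨σ, hσ0, hσ⟩ := hp.exists_side hd
  have hpt : ∀ r : ℝ, 0 < r → r < 1 →
      ∀ᶠ y in nhds (p + r • d), 0 < σ * cross d (y - p) → y ∈ P.region := by
    intro r hr0 hr1
    refine hp.eventually_mem_region hd hσ ?_ ?_
    · simp only [cross, add_sub_cancel_left, PiLp.smul_apply, smul_eq_mul]
      ring
    · have h1 : ∀ᶠ s in nhds (0 : ℝ), r + s ∈ Ioo (0 : ℝ) 1 :=
        ((continuous_const_add r).tendsto' 0 r (add_zero r)).eventually (Ioo_mem_nhds hr0 hr1)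
      filter_upwards [h1] with s hs
      apply hq
      rw [segment_eq_image_lineMap]
      refine ⟨r + s, Ioo_subset_Icc_self hs, ?_⟩
      rw [AffineMap.lineMap_apply_module', ← hdef, add_smul]
      abel
  rintro x hx
  rw [openSegment_eq_image_lineMap] at hx
  obtain ⟨r, ⟨hr0, hr1⟩, hxr⟩ := hx
  rw [AffineMap.lineMap_apply_module', ← hdef] at hxr
  let T : Set Plane := {y | 0 < σ * cross d (y - p) → y ∈ P.region}
  have hsub : segment ℝ p x ⊆ interior T := by
    rw [segment_eq_image_lineMap]
    rintro _ ⟨t, ht, rfl⟩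
    rcases ht.1.eq_or_lt with h0 | h0
    · rw [← h0, AffineMap.lineMap_apply_zero]
      exact mem_interior.mpr ⟨P.inside, fun y hy _ => P.inside_subset_region hy,
        P.isOpen_inside, hpi⟩
    · have he : AffineMap.lineMap p x t = p + (t * r) • d := by
        rw [AffineMap.lineMap_apply_module', ← hxr, mul_smul]
        simp [add_comm]
      rw [he, mem_interior_iff_mem_nhds]
      exact hpt _ (by positivity) (by nlinarith [ht.2])
  obtain ⟨δ, hδ, hthick⟩ :=
    (isCompact_segment_plane p x).exists_thickening_subset_open isOpen_interior hsub
  let N : Set Plane := Metric.ball x δ ∩ {y | 0 < σ * cross d (y - p)}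
  have hNo : IsOpen N := Metric.isOpen_ball.inter
    (isOpen_lt continuous_const ((continuous_cross_sub d p).const_mul σ |>.congr fun _ => rfl))
  have hNV : N ⊆ P.Vis p := by
    rintro y ⟨hyb, hypos⟩
    rw [P.mem_Vis, segment_eq_image_lineMap]
    rintro _ ⟨t, ht, rfl⟩
    rcases ht.1.eq_or_lt with h0 | h0
    · rw [← h0, AffineMap.lineMap_apply_zero]
      exact P.inside_subset_region hpi
    · have hz : AffineMap.lineMap p y t ∈ Metric.thickening δ (segment ℝ p x) := by
        rw [Metric.mem_thickening_iff]
        refine ⟨AffineMap.lineMap p x t, ?_, ?_⟩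
        · rw [segment_eq_image_lineMap]
          exact ⟨t, ht, rfl⟩
        · have hdist : dist (AffineMap.lineMap p y t) (AffineMap.lineMap p x t) = t * dist y x := by
            rw [dist_eq_norm, dist_eq_norm, AffineMap.lineMap_apply_module',
              AffineMap.lineMap_apply_module', add_sub_add_right_eq_sub, ← smul_sub,
              sub_sub_sub_cancel_right, norm_smul, Real.norm_of_nonneg h0.le]
          rw [hdist]
          have := Metric.mem_ball.mp hyb
          nlinarith [ht.2, dist_nonneg (x := y) (y := x)]
      refine interior_subset (hthick hz) ?_
      have hp0 : cross d (p - p) = 0 := by simp [cross]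
      rw [cross_lineMap_sub, hp0]
      have := mul_pos h0 hypos
      linarith
  refine closure_mono (interior_maximal hNV hNo) ?_
  have hcont : Continuous fun t : ℝ => x + (t * σ) • quarterTurn d := by fun_prop
  refine mem_closure_of_tendsto
    ((hcont.tendsto' 0 x (by simp)).mono_left (nhdsWithin_le_nhds (s := Ioi 0))) ?_
  have hb : ∀ᶠ t in nhds (0 : ℝ), x + (t * σ) • quarterTurn d ∈ Metric.ball x δ :=
    (hcont.tendsto' 0 x (by simp)).eventually (Metric.ball_mem_nhds x hδ)
  filter_upwards [self_mem_nhdsWithin, nhdsWithin_le_nhds hb] with t ht htb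
  refine ⟨htb, ?_⟩
  have he : cross d (x + (t * σ) • quarterTurn d - p) = t * σ * cross d (quarterTurn d) := by
    rw [← hxr]
    simp only [cross, PiLp.sub_apply, PiLp.add_apply, PiLp.smul_apply, smul_eq_mul]
    ring
  change 0 < σ * _
  rw [he]
  have h1 := cross_quarterTurn_pos hd
  have h2 : 0 < t := ht
  have h3 : 0 < σ * σ := mul_self_pos.mpr hσ0
  have : 0 < (σ * σ) * (t * cross d (quarterTurn d)) := by positivity
  linarith

lemma Generic.visRegular {p : Plane} (hp : P.Generic p) (hpi : p ∈ P.inside) :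
    P.VisRegular p := by
  refine Subset.antisymm (fun q hq => ?_) ?_
  · by_cases hpq : p = q
    · subst hpq
      exact subset_closure (P.mem_interior_Vis_self hpi)
    · exact closure_minimal (hp.openSegment_subset hpi hq hpq) isClosed_closure
        (segment_subset_closure_openSegment (right_mem_segment ℝ p q))
  · exact closure_minimal interior_subset (P.isClosed_Vis p)

lemma eventually_segment_conic {a b : Plane} (hab : a ≠ b) (w : Plane) :
    ∀ᶠ y in nhds w, ∀ t ∈ Ioc (0 : ℝ) 1,
      AffineMap.lineMap w y t ∈ segment ℝ a b → y ∈ segment ℝ a b := by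
  by_cases hw : w ∈ segment ℝ a b
  · have hba : 0 < ‖b - a‖ := norm_pos_iff.mpr (sub_ne_zero.mpr hab.symm)
    rw [segment_eq_image_lineMap] at hw ⊢
    obtain ⟨s, hs, rfl⟩ := hw
    obtain ⟨m, hm0, hm1, hm2⟩ : ∃ m : ℝ, 0 < m ∧ (0 < s → m ≤ s) ∧ (s < 1 → m ≤ 1 - s) := by
      rcases hs.1.eq_or_lt with h0 | h0
      · exact ⟨1, one_pos, fun h => by linarith, fun h => by linarith⟩
      rcases hs.2.eq_or_lt with h1 | h1
      · exact ⟨1, one_pos, fun h => by linarith, fun h => by linarith⟩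
      · exact ⟨min s (1 - s), lt_min h0 (by linarith), fun _ => min_le_left _ _,
          fun _ => min_le_right _ _⟩
    filter_upwards [Metric.ball_mem_nhds _ (mul_pos hm0 hba)] with y hy t ht hmem
    obtain ⟨r, hr, hry⟩ := hmem
    simp only [AffineMap.lineMap_apply_module'] at hry hy ⊢
    have hy' : y - (s • (b - a) + a) = ((r - s) / t) • (b - a) := by
      have h1 : t • (y - (s • (b - a) + a)) = (r - s) • (b - a) := by
        rw [sub_smul, eq_sub_iff_add_eq]
        have h2 := hry
        rw [← add_assoc] at h2
        exact (add_right_cancel h2).symm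
      rw [div_eq_inv_mul, mul_smul, ← h1, smul_smul, inv_mul_cancel₀ ht.1.ne', one_smul]
    rw [Metric.mem_ball, dist_eq_norm, hy', norm_smul, Real.norm_eq_abs] at hy
    have hlt := lt_of_mul_lt_mul_right hy hba.le
    obtain ⟨ρ, hρ⟩ : ∃ ρ, ρ = (r - s) / t := ⟨_, rfl⟩
    rw [← hρ] at hlt hy'
    have hrt : r - s = ρ * t := by
      rw [hρ]
      field_simp [ht.1.ne']
    rw [abs_lt] at hlt
    refine ⟨s + ρ, ⟨?_, ?_⟩, ?_⟩
    · rcases hs.1.eq_or_lt with h0 | h0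
      · by_contra! hneg
        nlinarith [hr.1, ht.1]
      · linarith [hm1 h0]
    · rcases hs.2.eq_or_lt with h1 | h1
      · by_contra! hneg
        nlinarith [hr.2, ht.1]
      · linarith [hm2 h1]
    · rw [AffineMap.lineMap_apply_module', add_smul, ← hy']
      abel
  · obtain ⟨ε, hε, hb⟩ :=
      Metric.isOpen_iff.mp (isCompact_segment_plane a b).isClosed.isOpen_compl w hw
    filter_upwards [Metric.ball_mem_nhds w hε] with y hy t ht hmem
    refine absurd hmem (hb ((convex_ball w ε).segment_subset (Metric.mem_ball_self hε) hy ?_))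
    rw [segment_eq_image_lineMap]
    exact ⟨t, Ioc_subset_Icc_self ht, rfl⟩

variable (P)

lemma eventually_boundary_conic (w : Plane) : ∀ᶠ y in nhds w, ∀ t ∈ Ioc (0 : ℝ) 1,
    AffineMap.lineMap w y t ∈ P.boundary → y ∈ P.boundary := by
  have h : ∀ᶠ y in nhds w, ∀ i ∈ Finset.range P.n, ∀ t ∈ Ioc (0 : ℝ) 1,
      AffineMap.lineMap w y t ∈ segment ℝ (P.vertex i) (P.vertex (i + 1)) →
      y ∈ segment ℝ (P.vertex i) (P.vertex (i + 1)) := by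
    rw [Finset.eventually_all]
    intro i hi
    exact eventually_segment_conic (P.vertex_ne_vertex_succ (Finset.mem_range.mp hi)) w
  filter_upwards [h] with y hy t ht hmem
  obtain ⟨i, hi, him⟩ := P.mem_boundary.mp hmem
  exact P.mem_boundary.mpr ⟨i, hi, hy i (Finset.mem_range.mpr hi) t ht him⟩

lemma eventually_inside_subset_Vis {w : Plane} (hw : w ∈ P.region) :
    ∀ᶠ y in nhds w, y ∈ P.inside → y ∈ P.Vis w := by
  filter_upwards [P.eventually_boundary_conic w] with y hy hyi
  rw [P.mem_Vis, segment_eq_image_lineMap]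
  rintro _ ⟨t, ht, rfl⟩
  rcases ht.1.eq_or_lt with h0 | h0
  · rw [← h0, AffineMap.lineMap_apply_zero]
    exact hw
  · apply P.inside_subset_region
    refine P.mem_inside_of_joined hyi (S := AffineMap.lineMap w y '' Ioc (0 : ℝ) 1)
      ((convex_Ioc 0 1).isPreconnected.image _ AffineMap.lineMap_continuous.continuousOn) ?_
      ⟨1, ⟨one_pos, le_rfl⟩, AffineMap.lineMap_apply_one w y⟩ ⟨t, ⟨h0, ht.2⟩, rfl⟩
    rw [disjoint_left]
    rintro _ ⟨s, hs, rfl⟩ hsb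
    exact hyi.1 (hy s hs hsb)

lemma eventually_disjoint_Vis {w : Plane} {K : Set Plane} (hK : IsCompact K)
    (hwK : Disjoint (P.Vis w) K) : ∀ᶠ y in nhds w, Disjoint (P.Vis y) K := by
  obtain ⟨U, V, hU, -, hwU, hKV, hUV⟩ := generalized_tube_lemma (isCompact_singleton (x := w)) hK
    P.isClosed_setOf_visible.isOpen_compl (by
      rintro ⟨a, b⟩ ⟨ha, hb⟩ hab
      rw [mem_singleton_iff] at ha
      subst ha
      exact disjoint_left.mp hwK (P.mem_Vis.mpr hab) hb)
  filter_upwards [hU.mem_nhds (hwU rfl)] with y hy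
  rw [disjoint_left]
  intro q hq hqK
  exact hUV (mk_mem_prod hy (hKV hqK)) (P.mem_Vis.mp hq)

lemma exists_generic_mem_inside {w : Plane} (hw : w ∈ P.region) {S : Set Plane}
    (hS : S ∈ nhds w) : ∃ p ∈ S, p ∈ P.inside ∧ P.Generic p := by
  have hne : (interior S ∩ P.inside).Nonempty :=
    mem_closure_iff.mp (P.region_subset_closure_inside hw) _ isOpen_interior
      (mem_interior_iff_mem_nhds.mpr hS)
  obtain ⟨p, ⟨hpS, hpi⟩, hpg⟩ :=
    P.dense_generic.inter_open_nonempty _ (isOpen_interior.inter P.isOpen_inside) hne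
  exact ⟨p, interior_subset hpS, hpi, hpg⟩

end SimplePolygon

/-- Any witness can be replaced by a nearby witness whose visibility
region is regular, keeping a witness set of the same cardinality. -/
theorem witness_replace_regular (P : SimplePolygon) (W : Set Plane)
    (hW : P.IsWitnessSet W) (w : Plane) (hw : w ∈ W) :
    ∃ w' ∈ P.Vis w, P.IsWitnessSet ((W \ {w}) ∪ {w'}) ∧
      ((W \ {w}) ∪ {w'}).ncard = W.ncard ∧ P.VisRegular w' := by
  obtain ⟨hfin, hsub, hdisj⟩ := hW
  have hfin' : (W \ {w}).Finite := hfin.sdiff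
  have hK : IsCompact (⋃ x ∈ W \ {w}, P.Vis x) :=
    hfin'.isCompact_biUnion fun x _ => P.isCompact_Vis x
  have hwK : Disjoint (P.Vis w) (⋃ x ∈ W \ {w}, P.Vis x) := by
    rw [disjoint_iUnion₂_right]
    intro x hx
    exact disjoint_iff_inter_eq_empty.mpr (hdisj w hw x hx.1 (Ne.symm hx.2))
  obtain ⟨p, ⟨hpV, hpK⟩, hpi, hpg⟩ := P.exists_generic_mem_inside (hsub hw)
    ((P.eventually_inside_subset_Vis (hsub hw)).and (P.eventually_disjoint_Vis hK hwK))
  rw [disjoint_iUnion₂_right] at hpK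
  have hpr := P.inside_subset_region hpi
  have hpW : p ∉ W \ {w} := fun h =>
    disjoint_left.mp (hpK p h) (P.self_mem_Vis hpr) (P.self_mem_Vis hpr)
  refine ⟨p, hpV hpi, ⟨hfin'.union (finite_singleton p), ?_, ?_⟩, ?_, hpg.visRegular hpi⟩
  · exact union_subset (sdiff_subset.trans hsub) (singleton_subset_iff.mpr hpr)
  · rintro x (hx | rfl) y (hy | rfl) hxy
    · exact hdisj x hx.1 y hy.1 hxy
    · rw [inter_comm]
      exact disjoint_iff_inter_eq_empty.mp (hpK x hx)
    · exact disjoint_iff_inter_eq_empty.mp (hpK y hy)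
    · exact absurd rfl hxy
  · rw [union_singleton, ncard_insert_of_notMem hpW hfin', ncard_sdiff_singleton_add_one hw hfin]
end
end

section
/- Let P be a simple polygon, let a, b ∈ P, and let γ₁, γ₂ : [0,1] → P be continuous injective paths with γᵢ(0) = a and γᵢ(1) = b for i = 1, 2. Then every bounded connected component of ℝ² \ (γ₁([0,1]) ∪ γ₂([0,1])) contains no point of the topological frontier of P. -/
open Set

noncomputable section

/-- The component in `P.boundaryᶜ` of a point outside the polygon stays outside the polygon. -/
theorem SimplePolygon.connectedComponentIn_subset_compl_region (P : SimplePolygon) {y : Plane}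
    (hy : y ∉ P.region) : connectedComponentIn P.boundaryᶜ y ⊆ P.regionᶜ := by
  intro z hz hzr
  have hyb : y ∉ P.boundary := fun h => hy (Or.inl h)
  rcases hzr with hzb | ⟨-, hbdd⟩
  · exact connectedComponentIn_subset _ _ hz hzb
  · rw [← connectedComponentIn_eq hz] at hbdd
    exact hy (Or.inr ⟨hyb, hbdd⟩)

/-- The component in `P.boundaryᶜ` of a point outside the polygon is unbounded. -/
theorem SimplePolygon.not_isBounded_connectedComponentIn (P : SimplePolygon) {y : Plane}
    (hy : y ∉ P.region) : ¬ Bornology.IsBounded (connectedComponentIn P.boundaryᶜ y) :=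
  fun hbdd => hy (Or.inr ⟨fun h => hy (Or.inl h), hbdd⟩)

/-- A bounded component of the complement of a closed subset of the polygon contains no
point of the frontier of the polygon. -/
theorem SimplePolygon.inter_frontier_region_eq_empty (P : SimplePolygon) {K C : Set Plane}
    (hK : IsClosed K) (hKP : K ⊆ P.region) (hC : IsCompOf C Kᶜ)
    (hCb : Bornology.IsBounded C) : C ∩ frontier P.region = ∅ := by
  obtain ⟨x, -, rfl⟩ := hC
  refine eq_empty_iff_forall_notMem.mpr fun z ⟨hzC, hzf⟩ => ?_
  rw [frontier_eq_closure_inter_closure] at hzf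
  obtain ⟨y, hyC, hy⟩ :=
    mem_closure_iff.mp hzf.2 _ hK.isOpen_compl.connectedComponentIn hzC
  have hyb : y ∈ P.boundaryᶜ := fun h => hy (Or.inl h)
  refine P.not_isBounded_connectedComponentIn hy (hCb.subset ?_)
  rw [connectedComponentIn_eq hyC]
  exact isPreconnected_connectedComponentIn.subset_connectedComponentIn
    (mem_connectedComponentIn hyb)
    ((P.connectedComponentIn_subset_compl_region hy).trans (compl_subset_compl.mpr hKP))

/-- The bounded components of the complement of the union of two simple
paths in a simple polygon contain no point of the frontier of the polygon. -/
theorem no_frontier_inside_two_paths (P : SimplePolygon) (a b : Plane)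
    (ha : a ∈ P.region) (hb : b ∈ P.region)
    (γ₁ γ₂ : Path a b)
    (hc₁ : Set.range γ₁ ⊆ P.region) (hc₂ : Set.range γ₂ ⊆ P.region)
    (hi₁ : Function.Injective γ₁) (hi₂ : Function.Injective γ₂)
    (C : Set Plane) (hC : IsCompOf C (Set.range γ₁ ∪ Set.range γ₂)ᶜ)
    (hCb : Bornology.IsBounded C) :
    C ∩ frontier P.region = ∅ :=
  P.inter_frontier_region_eq_empty
    ((isCompact_range γ₁.continuous).union (isCompact_range γ₂.continuous)).isClosed
    (union_subset hc₁ hc₂) hC hCb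
end
end
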